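/- arXiv:math/0701669 — 8 statements merged into one kernel-verified Lean document; each statement's English description precedes it below -/
import Mathlib

section
/- Let N be the subgroup of ℚ⁸ generated by the standard basis vectors v₁, …, v₈ and the vector ½(v₁ + ⋯ + v₈), equipped with the bilinear form B(x,y) = −2 Σᵢ xᵢyᵢ. Then the set of elements x ∈ N with B(x,x) = −2 has exactly 16 elements, namely the vectors ±vᵢ for 1 ≤ i ≤ 8. -/
/-- The Nikulin lattice `N`: the subgroup of `ℚ⁸` generated by the standard basis
vectors `v₁, …, v₈` and `½(v₁ + ⋯ + v₈)`, equipped (below) with the bilinear form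
`B(x, y) = -2 Σᵢ xᵢ yᵢ`. -/
def NikulinLattice : AddSubgroup (Fin 8 → ℚ) :=
  AddSubgroup.closure
    (Set.range (fun i : Fin 8 => Pi.single i (1 : ℚ)) ∪ {fun _ => 1 / 2})

/-- Twice the coordinates of an element of the Nikulin lattice are integers of equal parity. -/
theorem NikulinLattice.exists_int_two_mul_eq {x : Fin 8 → ℚ} (hx : x ∈ NikulinLattice) :
    ∃ m : Fin 8 → ℤ, (∀ i, 2 * x i = m i) ∧ ∀ i j, (2 : ℤ) ∣ m i - m j := by
  refine AddSubgroup.closure_induction ?_ ?_ ?_ ?_ hx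
  · rintro _ (⟨k, rfl⟩ | rfl)
    · refine ⟨fun i => 2 * Pi.single (M := fun _ => ℤ) k 1 i, fun i => ?_, fun i j => ?_⟩
      · by_cases h : i = k <;> simp [h]
      · exact dvd_sub (dvd_mul_right _ _) (dvd_mul_right _ _)
    · exact ⟨fun _ => 1, by simp, by simp⟩
  · exact ⟨0, by simp, by simp⟩
  · rintro x y - - ⟨m, hm, hm'⟩ ⟨n, hn, hn'⟩
    refine ⟨m + n, fun i => by simp [mul_add, hm, hn], fun i j => ?_⟩
    have := dvd_add (hm' i j) (hn' i j)
    simpa [add_sub_add_comm] using this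
  · rintro x - ⟨m, hm, hm'⟩
    refine ⟨-m, fun i => by simp [hm], fun i j => ?_⟩
    have := hm' j i
    simpa [sub_eq_add_neg, add_comm] using this

/-- An integer vector of square norm one is a signed standard basis vector. -/
theorem Int.exists_eq_single_of_sum_mul_self_eq_one {ι : Type*} [Fintype ι] [DecidableEq ι]
    {n : ι → ℤ} (h : ∑ i, n i * n i = 1) :
    ∃ i, n = Pi.single i 1 ∨ n = -Pi.single i 1 := by
  obtain ⟨i, -, hi⟩ : ∃ i ∈ Finset.univ, n i * n i ≠ 0 :=
    Finset.exists_ne_zero_of_sum_ne_zero (by simp [h])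
  have hsum := Finset.add_sum_erase Finset.univ (fun j => n j * n j) (Finset.mem_univ i)
  have hnonneg : ∀ j ∈ Finset.univ.erase i, 0 ≤ n j * n j := fun j _ => mul_self_nonneg _
  have hrest := Finset.sum_nonneg hnonneg
  have hpos : 0 < n i * n i := lt_of_le_of_ne (mul_self_nonneg _) hi.symm
  simp only [h] at hsum
  have hzero : ∀ j, j ≠ i → n j = 0 := fun j hj =>
    mul_self_eq_zero.mp ((Finset.sum_eq_zero_iff_of_nonneg hnonneg).mp (by lia) j (by simp [hj]))
  refine ⟨i, (mul_self_eq_one_iff.mp (by linarith : n i * n i = 1)).imp (fun h1 => ?_) fun h1 => ?_⟩ <;>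
  · ext j
    by_cases hj : j = i
    · subst hj; simp [h1]
    · simp [hzero j hj, hj]

/-- The signed standard basis vectors in `ℚ^ι` number twice the dimension. -/
theorem ncard_setOf_eq_single_or_eq_neg_single {ι : Type*} [Fintype ι] [DecidableEq ι] :
    {x : ι → ℚ | ∃ i, x = Pi.single i 1 ∨ x = -Pi.single i 1}.ncard = 2 * Fintype.card ι := by
  let f : ι × ℤˣ → ι → ℚ := fun p => Pi.single p.1 ((p.2 : ℤ) : ℚ)
  have hf : Function.Injective f := by
    rintro ⟨i, u⟩ ⟨j, v⟩ h
    have hi := congrFun h i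
    by_cases hij : i = j
    · subst hij
      simpa [f, Units.ext_iff] using hi
    · simp [f, hij] at hi
  have hrange : {x : ι → ℚ | ∃ i, x = Pi.single i 1 ∨ x = -Pi.single i 1} = Set.range f := by
    ext x
    constructor
    · rintro ⟨i, rfl | rfl⟩
      · exact ⟨(i, 1), by simp [f]⟩
      · exact ⟨(i, -1), by simp [f, Pi.single_neg]⟩
    · rintro ⟨⟨i, u⟩, rfl⟩
      rcases Int.units_eq_one_or u with rfl | rfl
      · exact ⟨i, Or.inl (by simp [f])⟩
      · exact ⟨i, Or.inr (by simp [f, Pi.single_neg])⟩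
  rw [hrange, ← Set.image_univ, Set.ncard_image_of_injective _ hf, Set.ncard_univ,
    Nat.card_eq_fintype_card, Fintype.card_prod, Fintype.card_units_int, mul_comm]

/-- The roots of the Nikulin lattice are the signed standard basis vectors. -/
theorem NikulinLattice.setOf_roots_eq :
    {x : Fin 8 → ℚ | x ∈ NikulinLattice ∧ (-2 : ℚ) * ∑ i, x i * x i = -2} =
      {x : Fin 8 → ℚ | ∃ i : Fin 8, x = Pi.single i 1 ∨ x = -Pi.single i 1} := by
  ext x
  constructor
  · rintro ⟨hx, hroot⟩
    obtain ⟨m, hm, hpar⟩ := exists_int_two_mul_eq hx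
    have hsum : ∑ i, m i * m i = 4 := by
      have h : ∑ i, (m i : ℚ) * m i = 4 * ∑ i, x i * x i := by
        rw [Finset.mul_sum]
        exact Finset.sum_congr rfl fun i _ => by rw [← hm]; ring
      have h4 : ∑ i, (m i : ℚ) * m i = 4 := by linarith
      exact_mod_cast h4
    have heven : ∀ i, (2 : ℤ) ∣ m i := by
      by_contra! ⟨k, hk⟩
      have hge : ∀ i ∈ Finset.univ, 1 ≤ m i * m i := fun i _ => by
        have hi : m i ≠ 0 := fun h0 => hk (by simpa [h0] using hpar k i)
        have := mul_self_pos.mpr hi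
        lia
      have := Finset.sum_le_sum hge
      simp [hsum] at this
    choose n hn using heven
    have hxn : ∀ i, x i = n i := fun i => by
      have := hm i
      rw [hn i] at this
      push_cast at this
      linarith
    have hone : ∑ i, n i * n i = 1 := by
      have h : ∑ i, m i * m i = 4 * ∑ i, n i * n i := by
        rw [Finset.mul_sum]
        exact Finset.sum_congr rfl fun i _ => by rw [hn i]; ring
      lia
    obtain ⟨i, hi⟩ := Int.exists_eq_single_of_sum_mul_self_eq_one hone
    refine ⟨i, hi.imp (fun h => ?_) fun h => ?_⟩ <;>
    · ext j
      by_cases hj : j = i <;> simp [hxn, h, hj]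
  · rintro ⟨i, hi⟩
    have hmem : Pi.single i (1 : ℚ) ∈ NikulinLattice :=
      AddSubgroup.subset_closure (Or.inl ⟨i, rfl⟩)
    rcases hi with rfl | rfl
    · exact ⟨hmem, by simp [Pi.single_apply]⟩
    · exact ⟨neg_mem hmem, by simp [Pi.single_apply]⟩

/-- The Nikulin lattice has exactly `16` roots (elements `x` with `B(x,x) = -2`
for the form `B(x,y) = -2 Σ xᵢyᵢ`), namely the vectors `±vᵢ`, `1 ≤ i ≤ 8`. -/
theorem Nikulin_lattice_roots :
    {x : Fin 8 → ℚ | x ∈ NikulinLattice ∧ (-2 : ℚ) * ∑ i, x i * x i = -2} =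
      {x : Fin 8 → ℚ | ∃ i : Fin 8, x = Pi.single i 1 ∨ x = -Pi.single i 1} ∧
    {x : Fin 8 → ℚ | x ∈ NikulinLattice ∧ (-2 : ℚ) * ∑ i, x i * x i = -2}.ncard = 16 := by
  refine ⟨NikulinLattice.setOf_roots_eq, ?_⟩
  rw [NikulinLattice.setOf_roots_eq, ncard_setOf_eq_single_or_eq_neg_single, Fintype.card_fin]
end

section
/- Let Q be the collection of subsets of 𝔽₂⁴ consisting of the empty set, all of 𝔽₂⁴, and the 30 affine hyperplanes. Let K be the subgroup of the ℚ-vector space of functions 𝔽₂⁴ → ℚ generated by the standard basis vectors f_u (u ∈ 𝔽₂⁴) together with the vectors f_M = ½ Σ_{u ∈ M} f_u for M ∈ Q. Then K contains the subgroup ℤ^{𝔽₂⁴} of integer-valued functions, and the index [K : ℤ^{𝔽₂⁴}] equals 2⁵ = 32. -/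
/-- An affine hyperplane in `𝔽₂⁴`: a coset of a `3`-dimensional `𝔽₂`-subspace. -/
def IsAffineHyperplane (M : Set (Fin 4 → ZMod 2)) : Prop :=
  ∃ (H : Submodule (ZMod 2) (Fin 4 → ZMod 2)) (a : Fin 4 → ZMod 2),
    Module.finrank (ZMod 2) H = 3 ∧ M = {x | x - a ∈ H}

/-- The set `Q` of `32` subsets of `𝔽₂⁴`: the empty set, all of `𝔽₂⁴`, and the
`30` affine hyperplanes. -/
def Qcode : Set (Set (Fin 4 → ZMod 2)) :=
  {M | M = ∅ ∨ M = Set.univ ∨ IsAffineHyperplane M}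

/-- The Kummer lattice `K`: the subgroup of the ℚ-vector space of functions
`𝔽₂⁴ → ℚ` generated by the standard basis vectors `f_u` together with the
half-sums `f_M = ½ Σ_{u ∈ M} f_u` for `M ∈ Q`. -/
noncomputable def KummerLattice : AddSubgroup ((Fin 4 → ZMod 2) → ℚ) :=
  AddSubgroup.closure
    (Set.range (fun u : Fin 4 → ZMod 2 => Pi.single u (1 : ℚ)) ∪
      {f | ∃ M ∈ Qcode, f = Set.indicator M fun _ => (1 / 2 : ℚ)})

/-- The subgroup `ℤ^{𝔽₂⁴}` of integer-valued functions `𝔽₂⁴ → ℚ`. -/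
def IntegerValuedFns : AddSubgroup ((Fin 4 → ZMod 2) → ℚ) where
  carrier := {f | ∀ u, ∃ m : ℤ, f u = m}
  zero_mem' := fun u => ⟨0, by simp⟩
  add_mem' := by
    intro f g hf hg u
    obtain ⟨m, hm⟩ := hf u
    obtain ⟨n, hn⟩ := hg u
    exact ⟨m + n, by simp [hm, hn]⟩
  neg_mem' := by
    intro f hf u
    obtain ⟨m, hm⟩ := hf u
    exact ⟨-m, by simp [hm]⟩

/-- The half-sum `½ Σ f_u` over the points `u` where the affine-linear function `ℓ + c`
takes the value `1`. -/
def halfAffine (p : Module.Dual (ZMod 2) (Fin 4 → ZMod 2) × ZMod 2) :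
    (Fin 4 → ZMod 2) → ℚ :=
  fun x => ((p.1 x + p.2).val : ℚ) / 2

lemma ZMod.exists_val_add_div_two (x y : ZMod 2) :
    ∃ m : ℤ, -(((x + y).val : ℚ) / 2) + ((x.val : ℚ) / 2 + (y.val : ℚ) / 2) = m := by
  have h : ∀ x y : ZMod 2,
      (x + y).val = x.val + y.val ∨ (x + y).val + 2 = x.val + y.val := by decide
  rcases h x y with h | h
  · refine ⟨0, ?_⟩
    rw [h]; push_cast; ring
  · refine ⟨1, ?_⟩
    have h' : ((x + y).val : ℚ) + 2 = x.val + y.val := by exact_mod_cast h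
    push_cast; linarith

lemma ZMod.eq_zero_of_val_div_two_eq_intCast {x : ZMod 2} {m : ℤ} (h : (x.val : ℚ) / 2 = m) :
    x = 0 := by
  have h' : (x.val : ℤ) = 2 * m := by
    have : (x.val : ℚ) = 2 * m := by linarith
    exact_mod_cast this
  have hlt := ZMod.val_lt x
  exact (ZMod.val_eq_zero x).mp (by omega)

/-- Affine-linear functions on `𝔽₂⁴` as half-sums modulo integer-valued functions. -/
def halfAffineHom : Module.Dual (ZMod 2) (Fin 4 → ZMod 2) × ZMod 2 →+
    ((Fin 4 → ZMod 2) → ℚ) ⧸ IntegerValuedFns :=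
  AddMonoidHom.mk' (fun p => QuotientAddGroup.mk (halfAffine p)) fun p q => by
    rw [← QuotientAddGroup.mk_add, QuotientAddGroup.eq]
    intro u
    obtain ⟨m, hm⟩ := ZMod.exists_val_add_div_two (p.1 u + p.2) (q.1 u + q.2)
    refine ⟨m, ?_⟩
    rw [← hm]
    simp only [halfAffine, Pi.add_apply, Pi.neg_apply, Prod.fst_add, Prod.snd_add,
      LinearMap.add_apply, add_add_add_comm]

lemma halfAffineHom_injective : Function.Injective halfAffineHom := by
  rw [injective_iff_map_eq_zero]
  rintro ⟨l, c⟩ h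
  have h' : halfAffine (l, c) ∈ IntegerValuedFns := (QuotientAddGroup.eq_zero_iff _).mp h
  have key : ∀ x, l x + c = 0 := fun x =>
    let ⟨_, hm⟩ := h' x
    ZMod.eq_zero_of_val_div_two_eq_intCast hm
  have hc : c = 0 := by simpa using key 0
  have hl : l = 0 := LinearMap.ext fun x => by simpa [hc] using key x
  rw [hl, hc]; rfl

lemma halfAffine_eq_indicator (p : Module.Dual (ZMod 2) (Fin 4 → ZMod 2) × ZMod 2) :
    halfAffine p = Set.indicator {x | p.1 x + p.2 = 1} fun _ => (1 / 2 : ℚ) := by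
  have h01 : ∀ y : ZMod 2, y ≠ 1 → y = 0 := by decide
  ext x
  by_cases hx : p.1 x + p.2 = 1
  · rw [Set.indicator_of_mem (by exact hx), halfAffine, hx, ZMod.val_one]; norm_num
  · rw [Set.indicator_of_notMem (by exact hx), halfAffine, h01 _ hx]; simp

lemma finrank_ker_of_dual_ne_zero {l : Module.Dual (ZMod 2) (Fin 4 → ZMod 2)} (hl : l ≠ 0) :
    Module.finrank (ZMod 2) (LinearMap.ker l) = 3 := by
  have := Module.Dual.finrank_ker_add_one_of_ne_zero hl
  rw [Module.finrank_fin_fun] at this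
  omega

lemma mem_Qcode_iff {M : Set (Fin 4 → ZMod 2)} :
    M ∈ Qcode ↔ ∃ p : Module.Dual (ZMod 2) (Fin 4 → ZMod 2) × ZMod 2,
      M = {x | p.1 x + p.2 = 1} := by
  constructor
  · rintro (rfl | rfl | ⟨H, a, hH, rfl⟩)
    · exact ⟨(0, 0), by simp⟩
    · exact ⟨(0, 1), by simp⟩
    · have hlt : H < ⊤ := by
        refine lt_top_iff_ne_top.mpr fun h => ?_
        rw [h, finrank_top, Module.finrank_fin_fun] at hH
        omega
      obtain ⟨l, hl, hle⟩ := Submodule.exists_le_ker_of_lt_top H hlt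
      have hker : H = LinearMap.ker l :=
        Submodule.eq_of_le_of_finrank_eq hle (hH.trans (finrank_ker_of_dual_ne_zero hl).symm)
      refine ⟨(l, l a + 1), Set.ext fun x => ?_⟩
      have h2 : ∀ y z : ZMod 2, y - z = 0 ↔ y + (z + 1) = 1 := by decide
      simpa [hker] using h2 (l x) (l a)
  · rintro ⟨⟨l, c⟩, rfl⟩
    by_cases hl : l = 0
    · have h01 : c = 0 ∨ c = 1 := by revert c; decide
      rcases h01 with rfl | rfl
      · left; simp [hl]
      · right; left; simp [hl]
    · obtain ⟨a, ha⟩ := LinearMap.surjective hl (1 - c)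
      refine Or.inr (Or.inr ⟨LinearMap.ker l, a, finrank_ker_of_dual_ne_zero hl, ?_⟩)
      ext x
      simp only [Set.mem_ofPred_eq, LinearMap.mem_ker, map_sub, ha]
      rw [sub_eq_zero, eq_sub_iff_add_eq]

lemma single_mem_IntegerValuedFns (u : Fin 4 → ZMod 2) :
    Pi.single u (1 : ℚ) ∈ IntegerValuedFns := fun v => by
  by_cases h : v = u
  · subst h; exact ⟨1, by simp⟩
  · exact ⟨0, by simp [h]⟩

lemma IntegerValuedFns_le_KummerLattice : IntegerValuedFns ≤ KummerLattice := by
  intro f hf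
  choose m hm using hf
  have hsum : f = ∑ u, m u • (Pi.single u (1 : ℚ) : (Fin 4 → ZMod 2) → ℚ) := by
    ext v
    simp [Finset.sum_apply, Pi.single_apply, hm]
  rw [hsum]
  exact KummerLattice.sum_mem fun u _ =>
    KummerLattice.zsmul_mem (AddSubgroup.subset_closure (Or.inl ⟨u, rfl⟩)) _

lemma map_KummerLattice :
    KummerLattice.map (QuotientAddGroup.mk' IntegerValuedFns) = halfAffineHom.range := by
  apply le_antisymm
  · rw [KummerLattice, AddSubgroup.map_le_iff_le_comap, AddSubgroup.closure_le]
    rintro _ (⟨u, rfl⟩ | ⟨M, hM, rfl⟩)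
    · refine ⟨0, ?_⟩
      rw [map_zero]
      exact ((QuotientAddGroup.eq_zero_iff _).mpr (single_mem_IntegerValuedFns u)).symm
    · obtain ⟨p, rfl⟩ := mem_Qcode_iff.mp hM
      exact ⟨p, congrArg QuotientAddGroup.mk (halfAffine_eq_indicator p)⟩
  · rintro _ ⟨p, rfl⟩
    exact ⟨halfAffine p, AddSubgroup.subset_closure
      (Or.inr ⟨_, mem_Qcode_iff.mpr ⟨p, rfl⟩, halfAffine_eq_indicator p⟩), rfl⟩

/-- The Kummer lattice contains `ℤ^{𝔽₂⁴}`, with index `2⁵ = 32`. -/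
theorem kummer_lattice_index :
    IntegerValuedFns ≤ KummerLattice ∧
      (IntegerValuedFns.addSubgroupOf KummerLattice).index = 32 := by
  refine ⟨IntegerValuedFns_le_KummerLattice, ?_⟩
  have h := AddSubgroup.relIndex_ker KummerLattice (QuotientAddGroup.mk' IntegerValuedFns)
  rw [QuotientAddGroup.ker_mk', map_KummerLattice] at h
  refine h.trans ?_
  rw [← Nat.card_congr (AddMonoidHom.ofInjective halfAffineHom_injective).toEquiv, Nat.card_prod,
    Module.natCard_eq_pow_finrank (K := ZMod 2), Subspace.dual_finrank_eq, Module.finrank_fin_fun,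
    Nat.card_zmod]
  norm_num
end

section
/- Let k be a field, let a, a′, b, b′, b″ ∈ k with b″ ≠ 0, and let (x, y, t) ∈ k³ with t ≠ 0. Then y² = x³ + t³(at + a′)x + t⁵(b″t² + bt + b′) holds if and only if, setting t′ = b″t, x′ = x/t², y′ = yb″/t², one has y′² = t′³ + (x′³ + ax′ + b)t′² + b″(a′x′ + b′)t′. -/
/-- The change of variables `t' = b″t`, `x' = x/t²`, `y' = yb″/t²` transforms the
elliptic K3 surface `y² = x³ + t³(at + a′)x + t⁵(b″t² + bt + b′)` (with `E₈` and
`E₇` fibers) into the alternative fibration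
`y′² = t′³ + (x′³ + ax′ + b)t′² + b″(a′x′ + b′)t′` over the `x′`-line. -/
theorem alternative_fibration {k : Type*} [Field k] (a a' b b' b'' : k)
    (hb'' : b'' ≠ 0) (x y t : k) (ht : t ≠ 0) :
    y ^ 2 = x ^ 3 + t ^ 3 * (a * t + a') * x + t ^ 5 * (b'' * t ^ 2 + b * t + b') ↔
      (y * b'' / t ^ 2) ^ 2 =
        (b'' * t) ^ 3 + ((x / t ^ 2) ^ 3 + a * (x / t ^ 2) + b) * (b'' * t) ^ 2 +
          b'' * (a' * (x / t ^ 2) + b') * (b'' * t) := by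
  have key : (y * b'' / t ^ 2) ^ 2 -
      ((b'' * t) ^ 3 + ((x / t ^ 2) ^ 3 + a * (x / t ^ 2) + b) * (b'' * t) ^ 2 +
        b'' * (a' * (x / t ^ 2) + b') * (b'' * t)) =
      (b'' / t ^ 2) ^ 2 *
        (y ^ 2 - (x ^ 3 + t ^ 3 * (a * t + a') * x + t ^ 5 * (b'' * t ^ 2 + b * t + b'))) := by
    field_simp
    ring
  have hc : (b'' / t ^ 2) ^ 2 ≠ 0 := pow_ne_zero 2 (div_ne_zero hb'' (pow_ne_zero 2 ht))
  rw [← sub_eq_zero, ← sub_eq_zero (a := (y * b'' / t ^ 2) ^ 2), key, mul_eq_zero,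
    or_iff_right hc]
end

section
/- Let k be a field, let a, a′, b, b′, b″ ∈ k, and let (x, y, t) ∈ k³ with t ≠ 0 satisfy y² = x³ + t³(at + a′)x + t⁵(b″t² + bt + b′). Set u = x/t², T = y²/t⁶, and V = y(a′x + b′t² − b″t⁴)/t⁶. Then V² = T³ − 2(u³ + au + b)T² + ((u³ + au + b)² − 4b″(a′u + b′))T. -/
/-- The degree-`2` rational map from the K3 surface
`X : y² = x³ + t³(at + a′)x + t⁵(b″t² + bt + b′)` to the `2`-isogenous elliptic
surface `Y : V² = T³ - 2(u³ + au + b)T² + ((u³ + au + b)² - 4b″(a′u + b′))T`,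
given by `u = x/t²`, `T = y²/t⁶`, `V = y(a′x + b′t² - b″t⁴)/t⁶`. -/
theorem quotient_map_to_isogenous_surface {k : Type*} [Field k]
    (a a' b b' b'' x y t : k) (ht : t ≠ 0)
    (h : y ^ 2 = x ^ 3 + t ^ 3 * (a * t + a') * x + t ^ 5 * (b'' * t ^ 2 + b * t + b'))
    (u T V : k) (hu : u = x / t ^ 2) (hT : T = y ^ 2 / t ^ 6)
    (hV : V = y * (a' * x + b' * t ^ 2 - b'' * t ^ 4) / t ^ 6) :
    V ^ 2 = T ^ 3 - 2 * (u ^ 3 + a * u + b) * T ^ 2 +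
      ((u ^ 3 + a * u + b) ^ 2 - 4 * b'' * (a' * u + b')) * T := by
  have hTA : T - (u ^ 3 + a * u + b) = b'' * t + (a' * u + b') / t := by
    rw [hT, h, hu]
    field_simp
    ring
  have hV' : V ^ 2 = T * (b'' * t - (a' * u + b') / t) ^ 2 := by
    rw [hV, hT, hu]
    field_simp
    ring
  have hdisc : (b'' * t - (a' * u + b') / t) ^ 2 =
      (b'' * t + (a' * u + b') / t) ^ 2 - 4 * b'' * (a' * u + b') := by
    field_simp
    ring
  rw [hV', hdisc, ← hTA]
  ring
end

section
/- Let θ₁, …, θ₆ be indeterminates and let f(x) = Π_{i=1}^{6}(x − θᵢ) = Σ_{i=0}^{6} fᵢxⁱ be the monic sextic with roots θᵢ (so f₆ = 1). With K₂, K₁, K₀ defined as in the context, the polynomial identity K₁² − 4K₀K₂ = 16 · Π_{i=1}^{6}(θᵢ²z₁ − θᵢz₂ + z₃) holds in ℤ[θ₁, …, θ₆, z₁, z₂, z₃]. -/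
open Polynomial in
/-- A product of three linear factors, written out in elementary symmetric polynomials. -/
theorem prod_three_X_sub_C {R : Type*} [CommRing R] (r s t : R) :
    (X - C r) * (X - C s) * (X - C t) =
      X ^ 3 + C (-(r + s + t)) * X ^ 2 + C (r * s + r * t + s * t) * X + C (-(r * s * t)) := by
  simp only [map_add, map_mul, map_neg]
  ring

open Polynomial in
/-- The product of two monic cubics, collected by powers of `X`. -/
theorem mul_monic_cubics {R : Type*} [CommRing R] (a b c u v w : R) :
    (X ^ 3 + C a * X ^ 2 + C b * X + C c) * (X ^ 3 + C u * X ^ 2 + C v * X + C w) =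
      X ^ 6 + C (a + u) * X ^ 5 + C (b + a * u + v) * X ^ 4
        + C (c + b * u + a * v + w) * X ^ 3 + C (c * u + b * v + a * w) * X ^ 2
        + C (c * v + b * w) * X + C (c * w) := by
  simp only [map_add, map_mul]
  ring

/-- The resultant of the monic cubic `x³ + ax² + bx + c` and the quadratic `z₁x² - z₂x + z₃`. -/
def cubicResultant {R : Type*} [CommRing R] (a b c z₁ z₂ z₃ : R) : R :=
  z₃ ^ 3 + a * z₃ ^ 2 * z₂ + b * z₃ * (z₂ ^ 2 - 2 * z₁ * z₃)
    + c * (z₂ ^ 3 - 3 * z₁ * z₂ * z₃) + a ^ 2 * z₁ * z₃ ^ 2 + a * b * z₁ * z₂ * z₃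
    + a * c * z₁ * (z₂ ^ 2 - 2 * z₁ * z₃) + b ^ 2 * z₁ ^ 2 * z₃ + b * c * z₁ ^ 2 * z₂
    + c ^ 2 * z₁ ^ 3

theorem prod_three_tropes {R : Type*} [CommRing R] (r s t z₁ z₂ z₃ : R) :
    (r ^ 2 * z₁ - r * z₂ + z₃) * (s ^ 2 * z₁ - s * z₂ + z₃) * (t ^ 2 * z₁ - t * z₂ + z₃) =
      cubicResultant (-(r + s + t)) (r * s + r * t + s * t) (-(r * s * t)) z₁ z₂ z₃ := by
  unfold cubicResultant
  ring

/-- For the monic sextic `f(x) = Π (x - θᵢ) = Σ fᵢxⁱ` and the coefficients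
`K₂, K₁, K₀` of the Kummer quartic `K₂z₄² + K₁z₄ + K₀` of the Jacobian of
`y² = f(x)`, one has the identity `K₁² - 4K₀K₂ = 16 Π (θᵢ²z₁ - θᵢz₂ + z₃)`,
the product being over the six tropes `Tᵢ`. -/
theorem kummer_quartic_discriminant_is_tropes {R : Type*} [CommRing R]
    (θ : Fin 6 → R) (z₁ z₂ z₃ : R)
    (f : Polynomial R) (hf : f = ∏ i, (Polynomial.X - Polynomial.C (θ i)))
    (f₀ f₁ f₂ f₃ f₄ f₅ f₆ : R)
    (h₀ : f₀ = f.coeff 0) (h₁ : f₁ = f.coeff 1) (h₂ : f₂ = f.coeff 2)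
    (h₃ : f₃ = f.coeff 3) (h₄ : f₄ = f.coeff 4) (h₅ : f₅ = f.coeff 5)
    (h₆ : f₆ = f.coeff 6)
    (K₂ K₁ K₀ : R)
    (hK₂ : K₂ = z₂ ^ 2 - 4 * z₁ * z₃)
    (hK₁ : K₁ = -4 * z₁ ^ 3 * f₀ - 2 * z₁ ^ 2 * z₂ * f₁ - 4 * z₁ ^ 2 * z₃ * f₂
      - 2 * z₁ * z₂ * z₃ * f₃ - 4 * z₁ * z₃ ^ 2 * f₄ - 2 * z₂ * z₃ ^ 2 * f₅
      - 4 * z₃ ^ 3 * f₆)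
    (hK₀ : K₀ = -4 * z₁ ^ 4 * f₀ * f₂ + z₁ ^ 4 * f₁ ^ 2 - 4 * z₁ ^ 3 * z₂ * f₀ * f₃
      - 2 * z₁ ^ 3 * z₃ * f₁ * f₃ - 4 * z₁ ^ 2 * z₂ ^ 2 * f₀ * f₄
      + 4 * z₁ ^ 2 * z₂ * z₃ * f₀ * f₅ - 4 * z₁ ^ 2 * z₂ * z₃ * f₁ * f₄
      - 4 * z₁ ^ 2 * z₃ ^ 2 * f₀ * f₆ + 2 * z₁ ^ 2 * z₃ ^ 2 * f₁ * f₅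
      - 4 * z₁ ^ 2 * z₃ ^ 2 * f₂ * f₄ + z₁ ^ 2 * z₃ ^ 2 * f₃ ^ 2
      - 4 * z₁ * z₂ ^ 3 * f₀ * f₅ + 8 * z₁ * z₂ ^ 2 * z₃ * f₀ * f₆
      - 4 * z₁ * z₂ ^ 2 * z₃ * f₁ * f₅ + 4 * z₁ * z₂ * z₃ ^ 2 * f₁ * f₆
      - 4 * z₁ * z₂ * z₃ ^ 2 * f₂ * f₅ - 2 * z₁ * z₃ ^ 3 * f₃ * f₅
      - 4 * z₂ ^ 4 * f₀ * f₆ - 4 * z₂ ^ 3 * z₃ * f₁ * f₆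
      - 4 * z₂ ^ 2 * z₃ ^ 2 * f₂ * f₆ - 4 * z₂ * z₃ ^ 3 * f₃ * f₆
      - 4 * z₃ ^ 4 * f₄ * f₆ + z₃ ^ 4 * f₅ ^ 2) :
    K₁ ^ 2 - 4 * K₀ * K₂ = 16 * ∏ i, (θ i ^ 2 * z₁ - θ i * z₂ + z₃) := by
  have prod_six : ∀ {S : Type _} [CommRing S] (g : Fin 6 → S),
      ∏ i, g i = (g 0 * g 1 * g 2) * (g 3 * g 4 * g 5) := by
    intro S _ g
    rw [Fin.prod_univ_six]
    ring
  rw [prod_six, prod_three_X_sub_C, prod_three_X_sub_C] at hf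
  rw [prod_six, prod_three_tropes, prod_three_tropes]
  generalize -(θ 0 + θ 1 + θ 2) = a at *
  generalize θ 0 * θ 1 + θ 0 * θ 2 + θ 1 * θ 2 = b at *
  generalize -(θ 0 * θ 1 * θ 2) = c at *
  generalize -(θ 3 + θ 4 + θ 5) = u at *
  generalize θ 3 * θ 4 + θ 3 * θ 5 + θ 4 * θ 5 = v at *
  generalize -(θ 3 * θ 4 * θ 5) = w at *
  rw [mul_monic_cubics] at hf
  simp only [hf, Polynomial.coeff_add, Polynomial.coeff_C_mul, Polynomial.coeff_X_pow,
    Polynomial.coeff_X, Polynomial.coeff_C] at h₀ h₁ h₂ h₃ h₄ h₅ h₆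
  norm_num at h₀ h₁ h₂ h₃ h₄ h₅ h₆
  subst h₀ h₁ h₂ h₃ h₄ h₅ h₆ hK₂ hK₁ hK₀
  unfold cubicResultant
  ring
end

section
/- Let θ₁, …, θ₆ be indeterminates, f(x) = Π_{i=1}^{6}(x − θᵢ) = Σ fᵢxⁱ the monic sextic, and K(z₁,z₂,z₃,z₄) = K₂z₄² + K₁z₄ + K₀ with K₂, K₁, K₀ as in the context. Let h(x) = Π_{k=3}^{6}(x − θ_k) = Σ_{n=0}^{4} hₙxⁿ and β₀ = −h₀ − h₂(θ₁θ₂) − h₄(θ₁θ₂)². Then K and all four formal partial derivatives ∂K/∂z₁, ∂K/∂z₂, ∂K/∂z₃, ∂K/∂z₄ vanish under the substitution (z₁, z₂, z₃, z₄) = (1, θ₁ + θ₂, θ₁θ₂, β₀), as identities in ℚ[θ₁, …, θ₆]. -/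
open Polynomial in
/-- The coefficients of the product of a monic quadratic and a quartic. -/
theorem coeff_quadratic_mul_quartic {R : Type*} [CommRing R] (s p h₀ h₁ h₂ h₃ h₄ : R) :
    let f : R[X] := (X ^ 2 - C s * X + C p) *
      (C h₄ * X ^ 4 + C h₃ * X ^ 3 + C h₂ * X ^ 2 + C h₁ * X + C h₀)
    f.coeff 0 = p * h₀ ∧ f.coeff 1 = p * h₁ - s * h₀ ∧ f.coeff 2 = p * h₂ - s * h₁ + h₀ ∧
      f.coeff 3 = p * h₃ - s * h₂ + h₁ ∧ f.coeff 4 = p * h₄ - s * h₃ + h₂ ∧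
      f.coeff 5 = h₃ - s * h₄ ∧ f.coeff 6 = h₄ := by
  intro f
  have hf : f = C h₄ * X ^ 6 + C (h₃ - s * h₄) * X ^ 5 + C (p * h₄ - s * h₃ + h₂) * X ^ 4 +
      C (p * h₃ - s * h₂ + h₁) * X ^ 3 + C (p * h₂ - s * h₁ + h₀) * X ^ 2 +
      C (p * h₁ - s * h₀) * X + C (p * h₀) := by
    simp only [f, map_add, map_sub, map_mul]
    ring
  rw [hf]
  simp [coeff_X, coeff_C, coeff_X_pow, -map_add, -map_sub, -map_mul]


/-- The point `p₁₂ = (1 : θ₁ + θ₂ : θ₁θ₂ : β₀)` is a node (singular point) of the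
Kummer quartic `K(z₁,z₂,z₃,z₄) = K₂z₄² + K₁z₄ + K₀` of the Jacobian of the genus
`2` curve `y² = f(x) = Π (x - θᵢ)`: the polynomial `K` and all four of its formal
partial derivatives `∂K/∂zⱼ` vanish there, as identities in `ℚ[θ₁, …, θ₆]`. -/
theorem node_is_singular_point
    (θ : Fin 6 → MvPolynomial (Fin 6) ℚ) (hθ : θ = fun i => MvPolynomial.X i)
    (f : Polynomial (MvPolynomial (Fin 6) ℚ))
    (hf : f = ∏ i, (Polynomial.X - Polynomial.C (θ i)))
    (z : Fin 4 → MvPolynomial (Fin 4) (MvPolynomial (Fin 6) ℚ))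
    (hz : z = fun j => MvPolynomial.X j)
    (c : MvPolynomial (Fin 6) ℚ → MvPolynomial (Fin 4) (MvPolynomial (Fin 6) ℚ))
    (hc : c = MvPolynomial.C)
    (K₂ K₁ K₀ K : MvPolynomial (Fin 4) (MvPolynomial (Fin 6) ℚ))
    (hK₂ : K₂ = z 1 ^ 2 - 4 * z 0 * z 2)
    (hK₁ : K₁ = -4 * z 0 ^ 3 * c (f.coeff 0) - 2 * z 0 ^ 2 * z 1 * c (f.coeff 1)
      - 4 * z 0 ^ 2 * z 2 * c (f.coeff 2) - 2 * z 0 * z 1 * z 2 * c (f.coeff 3)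
      - 4 * z 0 * z 2 ^ 2 * c (f.coeff 4) - 2 * z 1 * z 2 ^ 2 * c (f.coeff 5)
      - 4 * z 2 ^ 3 * c (f.coeff 6))
    (hK₀ : K₀ = -4 * z 0 ^ 4 * c (f.coeff 0 * f.coeff 2) + z 0 ^ 4 * c (f.coeff 1 ^ 2)
      - 4 * z 0 ^ 3 * z 1 * c (f.coeff 0 * f.coeff 3)
      - 2 * z 0 ^ 3 * z 2 * c (f.coeff 1 * f.coeff 3)
      - 4 * z 0 ^ 2 * z 1 ^ 2 * c (f.coeff 0 * f.coeff 4)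
      + 4 * z 0 ^ 2 * z 1 * z 2 * c (f.coeff 0 * f.coeff 5)
      - 4 * z 0 ^ 2 * z 1 * z 2 * c (f.coeff 1 * f.coeff 4)
      - 4 * z 0 ^ 2 * z 2 ^ 2 * c (f.coeff 0 * f.coeff 6)
      + 2 * z 0 ^ 2 * z 2 ^ 2 * c (f.coeff 1 * f.coeff 5)
      - 4 * z 0 ^ 2 * z 2 ^ 2 * c (f.coeff 2 * f.coeff 4)
      + z 0 ^ 2 * z 2 ^ 2 * c (f.coeff 3 ^ 2)
      - 4 * z 0 * z 1 ^ 3 * c (f.coeff 0 * f.coeff 5)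
      + 8 * z 0 * z 1 ^ 2 * z 2 * c (f.coeff 0 * f.coeff 6)
      - 4 * z 0 * z 1 ^ 2 * z 2 * c (f.coeff 1 * f.coeff 5)
      + 4 * z 0 * z 1 * z 2 ^ 2 * c (f.coeff 1 * f.coeff 6)
      - 4 * z 0 * z 1 * z 2 ^ 2 * c (f.coeff 2 * f.coeff 5)
      - 2 * z 0 * z 2 ^ 3 * c (f.coeff 3 * f.coeff 5)
      - 4 * z 1 ^ 4 * c (f.coeff 0 * f.coeff 6)
      - 4 * z 1 ^ 3 * z 2 * c (f.coeff 1 * f.coeff 6)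
      - 4 * z 1 ^ 2 * z 2 ^ 2 * c (f.coeff 2 * f.coeff 6)
      - 4 * z 1 * z 2 ^ 3 * c (f.coeff 3 * f.coeff 6)
      - 4 * z 2 ^ 4 * c (f.coeff 4 * f.coeff 6) + z 2 ^ 4 * c (f.coeff 5 ^ 2))
    (hK : K = K₂ * z 3 ^ 2 + K₁ * z 3 + K₀)
    (h : Polynomial (MvPolynomial (Fin 6) ℚ))
    (hh : h = (Polynomial.X - Polynomial.C (θ 2)) * (Polynomial.X - Polynomial.C (θ 3))
      * (Polynomial.X - Polynomial.C (θ 4)) * (Polynomial.X - Polynomial.C (θ 5)))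
    (β₀ : MvPolynomial (Fin 6) ℚ)
    (hβ : β₀ = -(h.coeff 0) - h.coeff 2 * (θ 0 * θ 1) - h.coeff 4 * (θ 0 * θ 1) ^ 2)
    (v : Fin 4 → MvPolynomial (Fin 6) ℚ)
    (hv : v = ![1, θ 0 + θ 1, θ 0 * θ 1, β₀]) :
    MvPolynomial.eval v K = 0 ∧
      ∀ j : Fin 4, MvPolynomial.eval v (MvPolynomial.pderiv j K) = 0 := by
  have hdeg : h.natDegree ≤ 4 := by
    rw [hh]
    compute_degree
  have hsum : h = Polynomial.C (h.coeff 4) * Polynomial.X ^ 4 +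
      Polynomial.C (h.coeff 3) * Polynomial.X ^ 3 + Polynomial.C (h.coeff 2) * Polynomial.X ^ 2 +
      Polynomial.C (h.coeff 1) * Polynomial.X + Polynomial.C (h.coeff 0) := by
    conv_lhs => rw [h.as_sum_range_C_mul_X_pow' (Nat.lt_succ_of_le hdeg)]
    simp only [Finset.sum_range_succ, Finset.sum_range_zero]
    ring
  have hfac : f = (Polynomial.X ^ 2 - Polynomial.C (θ 0 + θ 1) * Polynomial.X +
      Polynomial.C (θ 0 * θ 1)) * h := by
    rw [hf, hh, Fin.prod_univ_six]
    simp only [map_add, map_mul]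
    ring
  rw [hsum] at hfac
  obtain ⟨hf₀, hf₁, hf₂, hf₃, hf₄, hf₅, hf₆⟩ := hfac ▸ coeff_quadratic_mul_quartic
    (θ 0 + θ 1) (θ 0 * θ 1) (h.coeff 0) (h.coeff 1) (h.coeff 2) (h.coeff 3) (h.coeff 4)
  rw [hf₀, hf₁, hf₂, hf₃, hf₄, hf₅, hf₆] at hK₀
  rw [hf₀, hf₁, hf₂, hf₃, hf₄, hf₅, hf₆] at hK₁
  clear hf₀ hf₁ hf₂ hf₃ hf₄ hf₅ hf₆ hfac hsum hdeg hf hh hθ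
  generalize h.coeff 0 = h₀ at *
  generalize h.coeff 1 = h₁ at *
  generalize h.coeff 2 = h₂ at *
  generalize h.coeff 3 = h₃ at *
  generalize h.coeff 4 = h₄ at *
  generalize θ 0 + θ 1 = s at *
  generalize θ 0 * θ 1 = p at *
  have hC4 : (4 : MvPolynomial (Fin 4) (MvPolynomial (Fin 6) ℚ)) = MvPolynomial.C 4 := rfl
  have hC2 : (2 : MvPolynomial (Fin 4) (MvPolynomial (Fin 6) ℚ)) = MvPolynomial.C 2 := rfl
  have hC8 : (8 : MvPolynomial (Fin 4) (MvPolynomial (Fin 6) ℚ)) = MvPolynomial.C 8 := rfl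
  rw [hC4] at hK₂
  rw [hC4, hC2] at hK₁
  rw [hC4, hC2, hC8] at hK₀
  subst hK hK₂ hK₁ hK₀ hc hz hv hβ
  refine ⟨?_, fun j => ?_⟩
  · simp only [map_add, map_sub, map_neg, map_mul, map_pow, MvPolynomial.eval_X,
      MvPolynomial.eval_C, Matrix.cons_val]
    ring
  · simp only [map_add, map_sub, map_neg, map_mul, map_pow, map_natCast, map_zero,
      MvPolynomial.pderiv_mul, MvPolynomial.pderiv_pow, MvPolynomial.pderiv_C,
      MvPolynomial.pderiv_X, MvPolynomial.eval_X, MvPolynomial.eval_C, Matrix.cons_val]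
    fin_cases j <;>
    · simp
      ring
end

section
/- Let k be a field of characteristic zero and X₁, …, X₆ ∈ k. There exist a, b, a′, b′ ∈ k such that Π_{i=1}^{6}(x − Xᵢ) = (x³ + ax + b)² + (a′x + b′) as polynomials in k[x] if and only if e₁(X₁,…,X₆) = 0 and e₂(X₁,…,X₆)² = 4e₄(X₁,…,X₆), where eⱼ denotes the j-th elementary symmetric polynomial. -/
open Finset

/-- Vieta's expansion of a product of linear factors indexed by a finite type. -/
theorem prod_X_sub_C_eq_sum_powersetCard {ι R : Type*} [Fintype ι] [CommRing R] (x : ι → R) :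
    ∏ i, (Polynomial.X - Polynomial.C (x i)) =
      ∑ j ∈ range (Fintype.card ι + 1), (-1) ^ j *
        (Polynomial.C (∑ s ∈ powersetCard j univ, ∏ i ∈ s, x i) *
          Polynomial.X ^ (Fintype.card ι - j)) := by
  simpa [Finset.esymm_map_val, Function.comp_def] using
    Multiset.prod_X_sub_X_eq_sum_esymm ((univ : Finset ι).val.map x)

/-- A monic sextic `Π (x - Xᵢ)` can be written in the form
`(x³ + ax + b)² + (a′x + b′)` iff the first elementary symmetric function of the
`Xᵢ` vanishes and `e₂² = 4e₄` — the equations of the Igusa quartic. -/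
theorem igusa_quartic_description {k : Type*} [Field k] [CharZero k]
    (X : Fin 6 → k) :
    (∃ a b a' b' : k,
        ∏ i, (Polynomial.X - Polynomial.C (X i)) =
          (Polynomial.X ^ 3 + Polynomial.C a * Polynomial.X + Polynomial.C b) ^ 2 +
            (Polynomial.C a' * Polynomial.X + Polynomial.C b')) ↔
      (∑ s ∈ Finset.powersetCard 1 (Finset.univ : Finset (Fin 6)), ∏ i ∈ s, X i) = 0 ∧
        (∑ s ∈ Finset.powersetCard 2 (Finset.univ : Finset (Fin 6)), ∏ i ∈ s, X i) ^ 2 =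
          4 * ∑ s ∈ Finset.powersetCard 4 (Finset.univ : Finset (Fin 6)), ∏ i ∈ s, X i := by
  have vieta := prod_X_sub_C_eq_sum_powersetCard X
  generalize he : (fun j => ∑ s ∈ powersetCard j (univ : Finset (Fin 6)), ∏ i ∈ s, X i) = e
  have he' (j : ℕ) : ∑ s ∈ powersetCard j (univ : Finset (Fin 6)), ∏ i ∈ s, X i = e j :=
    congrFun he j
  have e_zero : e 0 = 1 := by simp [← he']
  simp only [he', Fintype.card_fin] at vieta ⊢
  rw [vieta]
  simp only [sum_range_succ, range_zero, sum_empty, e_zero]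
  constructor
  · rintro ⟨a, b, a', b', h⟩
    have square_expansion :
        (Polynomial.X ^ 3 + Polynomial.C a * Polynomial.X + Polynomial.C b) ^ 2 +
            (Polynomial.C a' * Polynomial.X + Polynomial.C b') =
          Polynomial.X ^ 6 + Polynomial.C (2 * a) * Polynomial.X ^ 4 +
            Polynomial.C (2 * b) * Polynomial.X ^ 3 + Polynomial.C (a ^ 2) * Polynomial.X ^ 2 +
            Polynomial.C (2 * a * b + a') * Polynomial.X + Polynomial.C (b ^ 2 + b') := by
      simp only [map_add, map_mul, map_pow, map_ofNat]
      ring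
    rw [square_expansion] at h
    have h5 : e 1 = 0 := by
      simpa [pow_succ (-1 : Polynomial k), Polynomial.coeff_X, Polynomial.coeff_C,
        Polynomial.coeff_X_pow, -map_mul, -map_pow] using congrArg (Polynomial.coeff · 5) h
    have h4 : e 2 = 2 * a := by
      simpa [pow_succ (-1 : Polynomial k), Polynomial.coeff_X, Polynomial.coeff_C,
        Polynomial.coeff_X_pow, -map_mul, -map_pow] using congrArg (Polynomial.coeff · 4) h
    have h2 : e 4 = a ^ 2 := by
      simpa [pow_succ (-1 : Polynomial k), Polynomial.coeff_X, Polynomial.coeff_C,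
        Polynomial.coeff_X_pow, -map_mul, -map_pow] using congrArg (Polynomial.coeff · 2) h
    exact ⟨h5, by rw [h4, h2]; ring⟩
  · rintro ⟨h1, h2⟩
    obtain ⟨a, ha⟩ : ∃ a, e 2 = 2 * a := ⟨e 2 / 2, by ring⟩
    obtain ⟨b, hb⟩ : ∃ b, e 3 = -(2 * b) := ⟨-e 3 / 2, by ring⟩
    have h4 : e 4 = a ^ 2 := by
      rw [ha] at h2
      linear_combination -h2 / 4
    refine ⟨a, b, -e 5 - 2 * a * b, e 6 - b ^ 2, ?_⟩
    rw [h1, ha, hb, h4]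
    simp only [map_sub, map_neg, map_mul, map_pow, map_ofNat, map_zero, map_one]
    ring
end

section
/- Let k be a field of characteristic zero and I₂, I₄, I₆, I₁₀ ∈ k. Suppose (x, y, t) ∈ k³ with t ≠ 0 satisfies y² = x³ − t³((I₄/12)t + 1)x + t⁵((I₁₀/4)t² + ((I₂I₄ − 3I₆)/108)t + I₂/24). Set u = x/t², T = y²/t⁶, V = y(−x + (I₂/24)t² − (I₁₀/4)t⁴)/t⁶, and q(u) = u³ − (I₄/12)u + (I₂I₄ − 3I₆)/108. Then V² = T³ − 2q(u)T² + (q(u)² + I₁₀(u − I₂/24))T. -/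
/-- The explicit degree-`2` rational map from the elliptic K3 surface `X` of the
main theorem (with `E₈` and `E₇` fibers, and Weierstrass coefficients given by
the Igusa–Clebsch invariants `I₂, I₄, I₆, I₁₀`) to the elliptic fibration on the
Kummer surface `Y = Km(J(C))`, given by `u = x/t²`, `T = y²/t⁶`,
`V = y(-x + (I₂/24)t² - (I₁₀/4)t⁴)/t⁶`. -/
theorem map_to_kummer_fibration {k : Type*} [Field k] [CharZero k]
    (I₂ I₄ I₆ I₁₀ : k) (x y t : k) (ht : t ≠ 0)
    (h : y ^ 2 = x ^ 3 - t ^ 3 * ((I₄ / 12) * t + 1) * x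
      + t ^ 5 * ((I₁₀ / 4) * t ^ 2 + ((I₂ * I₄ - 3 * I₆) / 108) * t + I₂ / 24))
    (u T V q : k) (hu : u = x / t ^ 2) (hT : T = y ^ 2 / t ^ 6)
    (hV : V = y * (-x + (I₂ / 24) * t ^ 2 - (I₁₀ / 4) * t ^ 4) / t ^ 6)
    (hq : q = u ^ 3 - (I₄ / 12) * u + (I₂ * I₄ - 3 * I₆) / 108) :
    V ^ 2 = T ^ 3 - 2 * q * T ^ 2 + (q ^ 2 + I₁₀ * (u - I₂ / 24)) * T := by
  have hTq : T - q = I₁₀ / 4 * t - (u - I₂ / 24) / t := by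
    rw [hT, h, hq, hu]
    field_simp
    ring
  have hVT : V ^ 2 = T * (I₁₀ / 4 * t + (u - I₂ / 24) / t) ^ 2 := by
    rw [hV, hT, hu]
    field_simp
    ring
  have hprod : 4 * (I₁₀ / 4 * t) * ((u - I₂ / 24) / t) = I₁₀ * (u - I₂ / 24) := by
    field_simp
  rw [hVT]
  linear_combination T * hprod
    - T * (T - q + (I₁₀ / 4 * t - (u - I₂ / 24) / t)) * hTq
end
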